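/- Let d be a positive integer, R ≥ 0, y ≥ 0 and s > 1. There exists a constant C(d,R,y,s) > 0 such that for every u ∈ 𝒱(d) with ‖u‖_W ≤ R, one has ‖X_{J^y}(u)‖_{H^s} ≤ C(d,R,y,s)(1 + ‖u‖_{H^s}). -/

import Mathlib

open scoped BigOperators ComplexConjugate

noncomputable section

/-- The Hardy space `L²₊(𝕋)` of the circle, modeled by the Hilbert space `ℓ²(ℕ, ℂ)` of
sequences of nonnegative Fourier (= Taylor) coefficients. -/
abbrev Hardy : Type := lp (fun _ : ℕ => ℂ) 2

/-- The Fourier coefficients of an element of the Hardy space. -/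
def coeffs (f : Hardy) : ℕ → ℂ := fun n => f n

/-- Membership in the Sobolev space `Hˢ₊(𝕋)`, expressed on Fourier coefficients. -/
def InHs (s : ℝ) (u : ℕ → ℂ) : Prop :=
  Summable fun k : ℕ => ((1 : ℝ) + (k : ℝ) ^ 2) ^ s * ‖u k‖ ^ 2

/-- The `Hˢ` norm, expressed on Fourier coefficients. -/
def hsNorm (s : ℝ) (u : ℕ → ℂ) : ℝ :=
  Real.sqrt (∑' k : ℕ, ((1 : ℝ) + (k : ℝ) ^ 2) ^ s * ‖u k‖ ^ 2)

/-- Membership in the Wiener algebra `W`. -/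
def InW (u : ℕ → ℂ) : Prop := Summable fun k : ℕ => ‖u k‖

/-- The Wiener norm `‖u‖_W = Σ |û(k)|`. -/
def wienerNorm (u : ℕ → ℂ) : ℝ := ∑' k : ℕ, ‖u k‖

/-- The `L²` norm, expressed on Fourier coefficients. -/
def l2Norm (u : ℕ → ℂ) : ℝ := Real.sqrt (∑' k : ℕ, ‖u k‖ ^ 2)

/-- The Hankel operator `H_u(h) = Π(u h̄)`, expressed on Fourier coefficients:
`(H_u h)^(n) = Σ_p û(n+p) conj(ĥ(p))`. -/
def hankel (u h : ℕ → ℂ) : ℕ → ℂ := fun n => ∑' p : ℕ, u (n + p) * conj (h p)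

/-- The shifted Hankel operator `K_u = S* H_u`. -/
def shiftedHankel (u h : ℕ → ℂ) : ℕ → ℂ := fun n => hankel u h (n + 1)

/-- Fourier coefficients of the pointwise product `fg` of two holomorphic (Hardy class)
functions: the Cauchy product. -/
def mulCoeff (f g : ℕ → ℂ) : ℕ → ℂ := fun n => ∑ p ∈ Finset.range (n + 1), f p * g (n - p)

/-- Fourier coefficients of `T_{a b̄}(h) = Π(a b̄ h)` for `a, b, h` in the Hardy class. -/
def toeplitzAB (a b h : ℕ → ℂ) : ℕ → ℂ :=
  fun n => ∑' q : ℕ, conj (b q) * mulCoeff a h (n + q)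

/-- Fourier coefficients of `T_{ā}(h) = Π(ā h)` for `a, h` in the Hardy class. -/
def toeplitzConj (a h : ℕ → ℂ) : ℕ → ℂ := fun n => ∑' q : ℕ, conj (a q) * h (n + q)

/-- The Szegő nonlinearity `Π(|u|²u) = T_{u ū}(u)`. -/
def szegoNL (u : ℕ → ℂ) : ℕ → ℂ := toeplitzAB u u u

/-- The operator `B_u = (i/2) H_u² - i T_{|u|²}` of the Lax pair. -/
def laxB (u h : ℕ → ℂ) : ℕ → ℂ := fun n =>
  Complex.I / 2 * hankel u (hankel u h) n - Complex.I * toeplitzAB u u h n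

/-- The operator `C_u = (i/2) K_u² - i T_{|u|²}` of the Lax pair. -/
def laxC (u h : ℕ → ℂ) : ℕ → ℂ := fun n =>
  Complex.I / 2 * shiftedHankel u (shiftedHankel u h) n - Complex.I * toeplitzAB u u h n

/-- `u : ℝ → L²₊` is a (smooth in time, `Hˢ`-valued) solution of the cubic Szegő equation
`i ∂_t u = Π(|u|²u)`. -/
def IsSzegoSolution (s : ℝ) (u : ℝ → Hardy) : Prop :=
  (∀ t, InHs s (coeffs (u t))) ∧ ContDiff ℝ (⊤ : ℕ∞) u ∧
    ∀ t n, HasDerivAt (fun τ : ℝ => coeffs (u τ) n) (-Complex.I * szegoNL (coeffs (u t)) n) t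

/-- The Hankel operator with symbol `u` (composed with complex conjugation, which does not
change its range), as a linear map on finitely supported sequences. -/
def hankelLM (u : ℕ → ℂ) : (ℕ →₀ ℂ) →ₗ[ℂ] (ℕ → ℂ) :=
  Finsupp.lsum ℂ fun p => LinearMap.toSpanSingleton ℂ (ℕ → ℂ) fun n => u (n + p)

/-- The rank of the Hankel operator `H_u`. -/
def hankelRank (u : ℕ → ℂ) : ℕ := Module.finrank ℂ (LinearMap.range (hankelLM u))

/-- The finite rank manifold `𝒱(d)`: `u` with `rk H_u = [(d+1)/2]` and `rk K_u = [d/2]`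
(recall `K_u = H_{S*u}`). -/
def InV (d : ℕ) (u : ℕ → ℂ) : Prop :=
  InHs (1 / 2) u ∧ FiniteDimensional ℂ (LinearMap.range (hankelLM u)) ∧
    hankelRank u = (d + 1) / 2 ∧ hankelRank (fun n => u (n + 1)) = d / 2

/-- `w = w^y = (I + y H_u²)⁻¹(1)`, characterized by `(I + y H_u²) w = 1`. -/
def IsResolventOne (y : ℝ) (u w : ℕ → ℂ) : Prop :=
  Memℓp w 2 ∧ ∀ n, w n + (y : ℂ) * hankel u (hankel u w) n = if n = 0 then 1 else 0

/-- The Hamiltonian vector field `X_{J^y}(u) = 2iy w^y H_u(w^y)` (a pointwise product of two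
Hardy class functions), expressed on Fourier coefficients; `w` stands for `w^y`. -/
def XJ (y : ℝ) (u w : ℕ → ℂ) : ℕ → ℂ :=
  fun n => 2 * Complex.I * (y : ℂ) * mulCoeff w (hankel u w) n

/-- The operator `G_u^y(h) = -y w^y Π(conj(w^y) h) + y² (H_u w^y) Π(conj(H_u w^y) h)`;
`w` stands for `w^y`. -/
def Gop (y : ℝ) (u w h : ℕ → ℂ) : ℕ → ℂ := fun n =>
  -(y : ℂ) * mulCoeff w (toeplitzConj w h) n
    + (y : ℂ) ^ 2 * mulCoeff (hankel u w) (toeplitzConj (hankel u w) h) n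

/-- The operator `F_u^y(h) = G_u^y(h) - y² (h | H_u w^y) H_u w^y`; `w` stands for `w^y`. -/
def Fop (y : ℝ) (u w h : ℕ → ℂ) : ℕ → ℂ := fun n =>
  Gop y u w h n - (y : ℂ) ^ 2 * (∑' p : ℕ, h p * conj (hankel u w p)) * hankel u w n


lemma exists_lp_eq_tsum {q : ENNReal} [Fact (1 ≤ q)] (g : ℕ → lp (fun _ : ℕ => ℂ) q)
    (hg : Summable fun p => ‖g p‖) :
    ∃ F : lp (fun _ : ℕ => ℂ) q, (∀ n, F n = ∑' p, g p n) ∧ ‖F‖ ≤ ∑' p, ‖g p‖ := by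
  refine ⟨∑' p, g p, fun n => ?_, norm_tsum_le_tsum_norm hg⟩
  exact ((lp.evalCLM ℂ (fun _ : ℕ => ℂ) q n).hasSum hg.of_norm.hasSum).tsum_eq.symm

/-- The sequence of Fourier coefficients weighted so that its `ℓ²` norm is the `Hˢ` norm. -/
def sobolevWeight (s : ℝ) (u : ℕ → ℂ) : ℕ → ℂ :=
  fun k => (((1 + (k : ℝ) ^ 2) ^ (s / 2) : ℝ) : ℂ) * u k

lemma norm_sobolevWeight_sq (s : ℝ) (u : ℕ → ℂ) (k : ℕ) :
    ‖sobolevWeight s u k‖ ^ 2 = (1 + (k : ℝ) ^ 2) ^ s * ‖u k‖ ^ 2 := by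
  have h : (0 : ℝ) ≤ 1 + (k : ℝ) ^ 2 := by positivity
  rw [sobolevWeight, norm_mul, mul_pow, Complex.norm_real, Real.norm_of_nonneg (by positivity),
    ← Real.rpow_mul_natCast h]
  norm_num

lemma memℓp_sobolevWeight {s : ℝ} {u : ℕ → ℂ} : Memℓp (sobolevWeight s u) 2 ↔ InHs s u := by
  rw [memℓp_gen_iff (by norm_num), InHs]
  simp only [ENNReal.toReal_ofNat, Real.rpow_two, norm_sobolevWeight_sq]

lemma norm_sobolevWeight {s : ℝ} {u : ℕ → ℂ} (h : Memℓp (sobolevWeight s u) 2) :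
    ‖(⟨sobolevWeight s u, h⟩ : lp (fun _ : ℕ => ℂ) 2)‖ = hsNorm s u := by
  rw [lp.norm_eq_tsum_rpow (by norm_num), hsNorm, Real.sqrt_eq_rpow]
  simp only [ENNReal.toReal_ofNat, Real.rpow_two, norm_sobolevWeight_sq]

lemma hsNorm_nonneg (s : ℝ) (u : ℕ → ℂ) : 0 ≤ hsNorm s u := Real.sqrt_nonneg _

lemma inHs_tsum {s : ℝ} {g : ℕ → ℕ → ℂ} {c : ℕ → ℝ} (hg : ∀ p, InHs s (g p))
    (hc : ∀ p, hsNorm s (g p) ≤ c p) (hsum : Summable c) :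
    InHs s (fun n => ∑' p, g p n) ∧ hsNorm s (fun n => ∑' p, g p n) ≤ ∑' p, c p := by
  let G : ℕ → lp (fun _ : ℕ => ℂ) 2 := fun p => ⟨_, memℓp_sobolevWeight.2 (hg p)⟩
  have hG : ∀ p, ‖G p‖ ≤ c p := fun p => (norm_sobolevWeight _).trans_le (hc p)
  have hGs : Summable fun p => ‖G p‖ := hsum.of_nonneg_of_le (fun _ => norm_nonneg _) hG
  obtain ⟨F, hF, hFn⟩ := exists_lp_eq_tsum G hGs
  have e : (F : ℕ → ℂ) = sobolevWeight s (fun n => ∑' p, g p n) := by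
    ext n
    rw [hF, sobolevWeight, ← tsum_mul_left]
    rfl
  have hm : Memℓp (sobolevWeight s (fun n => ∑' p, g p n)) 2 := e ▸ lp.memℓp F
  refine ⟨memℓp_sobolevWeight.1 hm, ?_⟩
  have e' : F = ⟨_, hm⟩ := Subtype.ext e
  rw [← norm_sobolevWeight hm, ← e']
  exact hFn.trans (hGs.tsum_le_tsum hG hsum)

lemma InHs.add {s : ℝ} {f g : ℕ → ℂ} (hf : InHs s f) (hg : InHs s g) :
    InHs s (fun n => f n + g n) ∧ hsNorm s (fun n => f n + g n) ≤ hsNorm s f + hsNorm s g := by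
  have e : sobolevWeight s (fun n => f n + g n) = sobolevWeight s f + sobolevWeight s g := by
    ext n; simp [sobolevWeight, mul_add]
  have hf' := memℓp_sobolevWeight.2 hf
  have hg' := memℓp_sobolevWeight.2 hg
  have hm : Memℓp (sobolevWeight s (fun n => f n + g n)) 2 := e ▸ hf'.add hg'
  refine ⟨memℓp_sobolevWeight.1 hm, ?_⟩
  rw [← norm_sobolevWeight hm, ← norm_sobolevWeight hf', ← norm_sobolevWeight hg']
  refine le_trans (le_of_eq ?_) (norm_add_le _ _)
  congr 1
  exact Subtype.ext e

lemma hsNorm_le_mul {s A : ℝ} (hA : 0 ≤ A) {f g : ℕ → ℂ}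
    (h : (∀ t : Finset ℕ, ∑ k ∈ t, ((1 : ℝ) + (k : ℝ) ^ 2) ^ s * ‖f k‖ ^ 2
      ≤ A ^ 2 * ∑' k : ℕ, ((1 : ℝ) + (k : ℝ) ^ 2) ^ s * ‖g k‖ ^ 2)) :
    InHs s f ∧ hsNorm s f ≤ A * hsNorm s g := by
  have hs : InHs s f := summable_of_sum_le (fun k => by positivity) h
  refine ⟨hs, ?_⟩
  rw [hsNorm, hsNorm]
  refine (Real.sqrt_le_sqrt (hs.tsum_le_of_sum_le h)).trans_eq ?_
  rw [Real.sqrt_mul (by positivity), Real.sqrt_sq hA]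

lemma InHs.const_mul {s : ℝ} {f : ℕ → ℂ} (hf : InHs s f) (c : ℂ) :
    InHs s (fun n => c * f n) ∧ hsNorm s (fun n => c * f n) ≤ ‖c‖ * hsNorm s f := by
  refine hsNorm_le_mul (norm_nonneg c) fun t => ?_
  refine le_trans (le_of_eq ?_) (mul_le_mul_of_nonneg_left
    (Summable.sum_le_tsum t (fun k _ => by positivity) hf) (sq_nonneg _))
  rw [Finset.mul_sum]
  refine Finset.sum_congr rfl fun k _ => ?_
  rw [norm_mul]; ring

lemma inHs_shift {s : ℝ} (hs : 0 ≤ s) {f : ℕ → ℂ} (hf : InHs s f) (p : ℕ) :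
    InHs s (fun n => f (n + p)) ∧ hsNorm s (fun n => f (n + p)) ≤ hsNorm s f := by
  rw [← one_mul (hsNorm s f)]
  refine hsNorm_le_mul zero_le_one fun t => ?_
  rw [one_pow, one_mul]
  refine le_trans ?_ (Summable.sum_le_tsum (t.map (addRightEmbedding p))
    (fun k _ => by positivity) hf)
  rw [Finset.sum_map]
  refine Finset.sum_le_sum fun k _ => ?_
  simp only [addRightEmbedding_apply]
  gcongr
  simp

lemma inHs_hankel {s : ℝ} (hs : 0 ≤ s) {u h : ℕ → ℂ} (hu : InHs s u) (hh : InW h) :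
    InHs s (hankel u h) ∧ hsNorm s (hankel u h) ≤ wienerNorm h * hsNorm s u := by
  rw [wienerNorm, ← tsum_mul_right]
  have key : ∀ p, InHs s (fun n => u (n + p) * conj (h p)) ∧
      hsNorm s (fun n => u (n + p) * conj (h p)) ≤ ‖h p‖ * hsNorm s u := fun p => by
    obtain ⟨h1, h2⟩ := inHs_shift hs hu p
    obtain ⟨h3, h4⟩ := h1.const_mul (conj (h p))
    simp only [mul_comm (conj (h p))] at h3 h4
    rw [RCLike.norm_conj] at h4
    exact ⟨h3, h4.trans (by gcongr)⟩
  exact inHs_tsum (fun p => (key p).1) (fun p => (key p).2) (hh.mul_right _)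

lemma inHs_mul_shift {s : ℝ} (hs : 0 ≤ s) {g : ℕ → ℂ} (hg : InHs s g) (c : ℂ) (p : ℕ)
    (P : ℕ → Prop) [DecidablePred P] (hP : ∀ n, P n → 2 * p ≤ n) :
    InHs s (fun n => if P n then c * g (n - p) else 0) ∧
      hsNorm s (fun n => if P n then c * g (n - p) else 0) ≤ ‖c‖ * (2 ^ s * hsNorm s g) := by
  rw [← mul_assoc]
  refine hsNorm_le_mul (by positivity) fun t => ?_
  have h1 : ∑ k ∈ t, ((1 : ℝ) + (k : ℝ) ^ 2) ^ s * ‖if P k then c * g (k - p) else 0‖ ^ 2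
      = ∑ k ∈ t with P k, ((1 : ℝ) + (k : ℝ) ^ 2) ^ s * ‖c * g (k - p)‖ ^ 2 := by
    rw [Finset.sum_filter]
    refine Finset.sum_congr rfl fun k _ => ?_
    split_ifs <;> simp
  rw [h1]
  have hinj : Set.InjOn (fun k => k - p) (t.filter P : Set ℕ) := by
    intro a ha b hb hab
    have h2 := hP a (by simpa using (Finset.mem_filter.1 ha).2)
    have h3 := hP b (by simpa using (Finset.mem_filter.1 hb).2)
    simp only at hab
    omega
  refine le_trans ?_ (mul_le_mul_of_nonneg_left
    (Summable.sum_le_tsum ((t.filter P).image fun k => k - p) (fun k _ => by positivity) hg)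
    (sq_nonneg _))
  rw [Finset.sum_image hinj, Finset.mul_sum]
  refine Finset.sum_le_sum fun k hk => ?_
  have hk2 := hP k (Finset.mem_filter.1 hk).2
  have hle : (k : ℝ) ≤ 2 * ((k - p : ℕ) : ℝ) := by exact_mod_cast (by omega)
  have hw : ((1 : ℝ) + (k : ℝ) ^ 2) ^ s ≤ (2 ^ s) ^ 2 * (1 + ((k - p : ℕ) : ℝ) ^ 2) ^ s := by
    rw [sq (2 ^ s : ℝ), ← Real.mul_rpow (by norm_num) (by norm_num),
      ← Real.mul_rpow (by norm_num) (by positivity)]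
    refine Real.rpow_le_rpow (by positivity) ?_ hs
    norm_num
    nlinarith
  calc _ ≤ ((2 ^ s) ^ 2 * (1 + ((k - p : ℕ) : ℝ) ^ 2) ^ s) * ‖c * g (k - p)‖ ^ 2 := by gcongr
    _ = _ := by rw [norm_mul]; ring

lemma mulCoeff_eq (f g : ℕ → ℂ) (n : ℕ) :
    mulCoeff f g n = (∑' p, if 2 * p ≤ n then f p * g (n - p) else 0)
      + ∑' p, if 2 * p < n then g p * f (n - p) else 0 := by
  have e1 : (∑' p, if 2 * p ≤ n then f p * g (n - p) else 0)
      = ∑ p ∈ Finset.range (n + 1), if 2 * p ≤ n then f p * g (n - p) else 0 :=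
    tsum_eq_sum fun p hp => if_neg (by simp at hp; omega)
  have e2 : (∑' p, if 2 * p < n then g p * f (n - p) else 0)
      = ∑ p ∈ Finset.range (n + 1), if 2 * p < n then g p * f (n - p) else 0 :=
    tsum_eq_sum fun p hp => if_neg (by simp at hp; omega)
  rw [e1, e2, ← Finset.sum_range_reflect (fun p => if 2 * p < n then g p * f (n - p) else 0),
    ← Finset.sum_add_distrib, mulCoeff]
  refine Finset.sum_congr rfl fun p hp => ?_
  have hp : p ≤ n := by simpa [Nat.lt_succ_iff] using hp
  have h3 : n - (n + 1 - 1 - p) = p := by omega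
  rw [h3]
  have h4 : n + 1 - 1 - p = n - p := by omega
  rw [h4]
  by_cases h : 2 * p ≤ n
  · rw [if_pos h, if_neg (by omega), add_zero]
  · rw [if_neg h, if_pos (by omega), zero_add, mul_comm]

lemma inHs_mulCoeff {s : ℝ} (hs : 0 ≤ s) {f g : ℕ → ℂ} (hf : InHs s f) (hg : InHs s g)
    (hf' : InW f) (hg' : InW g) :
    InHs s (mulCoeff f g) ∧ hsNorm s (mulCoeff f g) ≤
      2 ^ s * (wienerNorm f * hsNorm s g + wienerNorm g * hsNorm s f) := by
  have key : ∀ {f g : ℕ → ℂ} (P : ℕ → ℕ → Prop) [∀ p, DecidablePred (P p)],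
      (∀ p n, P p n → 2 * p ≤ n) → InHs s g → InW f →
      InHs s (fun n => ∑' p, if P p n then f p * g (n - p) else 0) ∧
        hsNorm s (fun n => ∑' p, if P p n then f p * g (n - p) else 0) ≤
          wienerNorm f * (2 ^ s * hsNorm s g) := by
    intro f g P _ hP hg hf
    rw [wienerNorm, ← tsum_mul_right]
    exact inHs_tsum (fun p => (inHs_mul_shift hs hg (f p) p (P p) (hP p)).1)
      (fun p => (inHs_mul_shift hs hg (f p) p (P p) (hP p)).2) (hf.mul_right _)
  obtain ⟨a1, a2⟩ := key (f := f) (g := g) (fun p n => 2 * p ≤ n) (fun _ _ h => h) hg hf'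
  obtain ⟨b1, b2⟩ := key (f := g) (g := f) (fun p n => 2 * p < n) (fun _ _ h => h.le) hf hg'
  obtain ⟨c1, c2⟩ := a1.add b1
  simp only [← mulCoeff_eq] at c1 c2
  exact ⟨c1, by linarith⟩

lemma wienerNorm_nonneg (f : ℕ → ℂ) : 0 ≤ wienerNorm f := tsum_nonneg fun _ => norm_nonneg _

lemma InW.add {f g : ℕ → ℂ} (hf : InW f) (hg : InW g) : InW (f + g) :=
  (Summable.add hf hg).of_nonneg_of_le (fun _ => norm_nonneg _) fun _ => norm_add_le _ _

lemma InW.const_smul {f : ℕ → ℂ} (hf : InW f) (c : ℂ) : InW (c • f) := by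
  simpa [InW, norm_mul] using Summable.mul_left ‖c‖ hf

lemma wienerNorm_add_le {f g : ℕ → ℂ} (hf : InW f) (hg : InW g) :
    wienerNorm (f + g) ≤ wienerNorm f + wienerNorm g := by
  rw [wienerNorm, wienerNorm, wienerNorm, ← Summable.tsum_add hf hg]
  exact (hf.add hg).tsum_le_tsum (fun _ => norm_add_le _ _) (Summable.add hf hg)

lemma wienerNorm_smul (c : ℂ) (f : ℕ → ℂ) : wienerNorm (c • f) = ‖c‖ * wienerNorm f := by
  simp [wienerNorm, tsum_mul_left]

lemma wienerNorm_pos {f : ℕ → ℂ} (hf : InW f) (h : f ≠ 0) : 0 < wienerNorm f := by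
  obtain ⟨n, hn⟩ := Function.ne_iff.1 h
  exact hf.tsum_pos (fun _ => norm_nonneg _) n (norm_pos_iff.2 hn)

lemma InW.shift {u : ℕ → ℂ} (hu : InW u) (p : ℕ) :
    InW (fun n => u (n + p)) ∧ wienerNorm (fun n => u (n + p)) ≤ wienerNorm u := by
  refine ⟨(summable_nat_add_iff (f := fun n => ‖u n‖) p).2 hu, ?_⟩
  rw [wienerNorm, wienerNorm, ← Summable.sum_add_tsum_nat_add p hu]
  linarith [Finset.sum_nonneg fun (i : ℕ) (_ : i ∈ Finset.range p) => norm_nonneg (u i)]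

lemma InW.norm_le {u : ℕ → ℂ} (hu : InW u) (n : ℕ) : ‖u n‖ ≤ wienerNorm u :=
  hu.le_tsum n fun _ _ => norm_nonneg _

lemma InW.summable_hankel {u h : ℕ → ℂ} (hu : InW u) (hh : InW h) (n : ℕ) :
    Summable fun p => u (n + p) * conj (h p) := by
  refine Summable.of_norm_bounded (hh.mul_left (wienerNorm u)) fun p => ?_
  rw [norm_mul, RCLike.norm_conj]
  gcongr
  exact hu.norm_le _

lemma inW_iff_memℓp {u : ℕ → ℂ} : Memℓp u 1 ↔ InW u := by
  rw [memℓp_gen_iff (by norm_num), InW]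
  simp only [ENNReal.toReal_one, Real.rpow_one]

lemma norm_lp_one (f : lp (fun _ : ℕ => ℂ) 1) : ‖f‖ = wienerNorm f := by
  rw [lp.norm_eq_tsum_rpow (by norm_num), wienerNorm]
  simp only [ENNReal.toReal_one, Real.rpow_one, div_one]

lemma inW_hankel {u h : ℕ → ℂ} (hu : InW u) (hh : InW h) :
    InW (hankel u h) ∧ wienerNorm (hankel u h) ≤ wienerNorm u * wienerNorm h := by
  let G : ℕ → lp (fun _ : ℕ => ℂ) 1 := fun p =>
    ⟨conj (h p) • fun n => u (n + p), inW_iff_memℓp.2 ((hu.shift p).1.const_smul _)⟩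
  have hG : ∀ p, ‖G p‖ ≤ wienerNorm u * ‖h p‖ := fun p => by
    rw [norm_lp_one, wienerNorm_smul, RCLike.norm_conj, mul_comm]
    exact mul_le_mul_of_nonneg_right (hu.shift p).2 (norm_nonneg _)
  have hGs : Summable fun p => ‖G p‖ :=
    (hh.mul_left _).of_nonneg_of_le (fun _ => norm_nonneg _) hG
  obtain ⟨F, hF, hFn⟩ := exists_lp_eq_tsum G hGs
  have e : (F : ℕ → ℂ) = hankel u h := by
    ext n
    rw [hF, hankel]
    exact tsum_congr fun p => mul_comm _ _
  rw [← e, ← norm_lp_one]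
  refine ⟨inW_iff_memℓp.1 (lp.memℓp F), hFn.trans ?_⟩
  change _ ≤ wienerNorm u * ∑' k, ‖h k‖
  rw [← tsum_mul_left]
  exact hGs.tsum_le_tsum hG (hh.mul_left _)

lemma hankel_add {u f g : ℕ → ℂ} (hu : InW u) (hf : InW f) (hg : InW g) :
    hankel u (f + g) = hankel u f + hankel u g := by
  ext n
  simp only [hankel, Pi.add_apply, map_add, mul_add]
  exact (hu.summable_hankel hf n).tsum_add (hu.summable_hankel hg n)

lemma hankel_smul (u f : ℕ → ℂ) (c : ℂ) : hankel u (c • f) = conj c • hankel u f := by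
  ext n
  simp only [hankel, Pi.smul_apply, smul_eq_mul, map_mul, ← tsum_mul_left]
  exact tsum_congr fun p => by ring

lemma hankelLM_single (u : ℕ → ℂ) (p : ℕ) (c : ℂ) :
    hankelLM u (Finsupp.single p c) = c • fun n => u (n + p) := by
  simp [hankelLM]

lemma inW_of_mem_range {u x : ℕ → ℂ} (hu : InW u) (hx : x ∈ LinearMap.range (hankelLM u)) :
    InW x := by
  obtain ⟨c, rfl⟩ := hx
  induction c using Finsupp.induction_linear with
  | zero => rw [map_zero]; simp [InW]
  | add f g hf hg => rw [map_add]; exact hf.add hg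
  | single p c => rw [hankelLM_single]; exact (hu.shift p).1.const_smul c

lemma hankel_mem_range {u h : ℕ → ℂ} [FiniteDimensional ℂ (LinearMap.range (hankelLM u))]
    (hs : ∀ n, Summable fun p => u (n + p) * conj (h p)) :
    hankel u h ∈ LinearMap.range (hankelLM u) := by
  have h1 : HasSum (fun p => conj (h p) • fun n => u (n + p)) (hankel u h) := by
    rw [Pi.hasSum]
    intro n
    simpa only [Pi.smul_apply, smul_eq_mul, mul_comm (u _), hankel] using (hs n).hasSum
  refine (Submodule.closed_of_finiteDimensional (LinearMap.range (hankelLM u))).mem_of_tendsto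
    h1 (Filter.Eventually.of_forall fun t => Submodule.sum_mem _ fun p _ => ?_)
  exact ⟨Finsupp.single p (conj (h p)), hankelLM_single u p _⟩

lemma tsum_hankel_hankel_mul_conj {u v : ℕ → ℂ} (hu : InW u) (hv : InW v) :
    ∑' n, hankel u (hankel u v) n * conj (v n) = ((∑' p, ‖hankel u v p‖ ^ 2 : ℝ) : ℂ) := by
  have hH := (inW_hankel hu hv).1
  have hsum : Summable (Function.uncurry fun p n : ℕ =>
      u (n + p) * conj (hankel u v p) * conj (v n)) := by
    refine Summable.of_norm_bounded ((Summable.mul_of_nonneg hH hv (fun _ => norm_nonneg _)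
      fun _ => norm_nonneg _).mul_left (wienerNorm u)) fun x => ?_
    simp only [Function.uncurry, norm_mul, RCLike.norm_conj, mul_assoc]
    gcongr
    exact hu.norm_le _
  calc ∑' n, hankel u (hankel u v) n * conj (v n)
      = ∑' n, ∑' p, u (n + p) * conj (hankel u v p) * conj (v n) := by
        simp only [tsum_mul_right]; rfl
    _ = ∑' p, ∑' n, u (n + p) * conj (hankel u v p) * conj (v n) := hsum.tsum_comm
    _ = ∑' p, ((‖hankel u v p‖ ^ 2 : ℝ) : ℂ) := by
        refine tsum_congr fun p => ?_
        rw [Complex.ofReal_pow, ← Complex.mul_conj']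
        change _ = (∑' n, u (p + n) * conj (v n)) * conj (hankel u v p)
        rw [← tsum_mul_right]
        exact tsum_congr fun n => by rw [add_comm p n]; ring
    _ = _ := by rw [Complex.ofReal_tsum]

lemma one_le_norm_of_eigen {u v : ℕ → ℂ} (hu : InW u) (hv : InW v) (hv0 : v ≠ 0) {y : ℝ}
    (hy : 0 ≤ y) {μ : ℂ} (h : v + (y : ℂ) • hankel u (hankel u v) = μ • v) : 1 ≤ ‖μ‖ := by
  have hA := (inW_hankel hu (inW_hankel hu hv).1).1
  have hsq : Summable fun n => ‖v n‖ ^ 2 := by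
    refine (hv.mul_left (wienerNorm v)).of_nonneg_of_le (fun _ => by positivity) fun n => ?_
    rw [sq]
    gcongr
    exact hv.norm_le n
  have hAv : Summable fun n => hankel u (hankel u v) n * conj (v n) := by
    refine Summable.of_norm_bounded (hv.mul_left (wienerNorm (hankel u (hankel u v)))) fun n => ?_
    rw [norm_mul, RCLike.norm_conj]
    gcongr
    exact hA.norm_le n
  have hvv : Summable fun n => ((‖v n‖ ^ 2 : ℝ) : ℂ) := Complex.ofRealCLM.summable hsq
  obtain ⟨m, hm⟩ := Function.ne_iff.1 hv0
  set a := ∑' n, ‖v n‖ ^ 2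
  set b := ∑' n, ‖hankel u v n‖ ^ 2
  have ha : 0 < a := hsq.tsum_pos (fun _ => by positivity) m (pow_pos (norm_pos_iff.2 hm) 2)
  have hb : 0 ≤ b := tsum_nonneg fun _ => by positivity
  have key : (a : ℂ) + y * b = μ * a := by
    rw [← tsum_hankel_hankel_mul_conj hu hv, Complex.ofReal_tsum, ← tsum_mul_left,
      ← tsum_mul_left, ← hvv.tsum_add (hAv.mul_left _)]
    refine tsum_congr fun n => ?_
    have hn := congrFun h n
    simp only [Pi.add_apply, Pi.smul_apply, smul_eq_mul] at hn
    rw [Complex.ofReal_pow, ← Complex.mul_conj']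
    linear_combination conj (v n) * hn
  have hre := congrArg Complex.re key
  simp only [Complex.add_re, Complex.ofReal_re, Complex.re_mul_ofReal] at hre
  have : 1 ≤ μ.re := by
    by_contra! hlt
    nlinarith [mul_nonneg hy hb]
  exact this.trans (Complex.re_le_norm μ)

/-- A bounded operator annihilating `x` through a product of `n` factors `T - μ` with
`1 ≤ ‖μ‖ ≤ M` is bounded from below at `x` by a constant depending only on `n` and `M`. -/
lemma seminorm_le_of_aeval_prod {E : Type*} [AddCommGroup E] [Module ℂ E] (N : Seminorm ℂ E)
    (T : Module.End ℂ E) {M : ℝ} (hM : 0 ≤ M) (hT : ∀ x, N (T x) ≤ M * N x) (s : Multiset ℂ)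
    (hs : ∀ μ ∈ s, 1 ≤ ‖μ‖ ∧ ‖μ‖ ≤ M) (x : E) :
    N x ≤ N (Polynomial.aeval T (s.map fun μ => Polynomial.X - Polynomial.C μ).prod x)
      + (∑ i ∈ Finset.range (Multiset.card s), (2 * M) ^ i) * N (T x) := by
  induction s using Multiset.induction_on generalizing x with
  | empty => simp
  | cons μ s ih =>
    obtain ⟨h1, h2⟩ := hs μ (Multiset.mem_cons_self _ _)
    set z := T x - μ • x with hz
    have e : Polynomial.aeval T
        ((μ ::ₘ s).map fun μ => Polynomial.X - Polynomial.C μ).prod x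
        = Polynomial.aeval T (s.map fun μ => Polynomial.X - Polynomial.C μ).prod z := by
      rw [Multiset.map_cons, Multiset.prod_cons, mul_comm, map_mul, Module.End.mul_apply]
      congr 1
      simp [hz, Module.algebraMap_end_apply]
    have hsub : ∀ x, N (T x - μ • x) ≤ 2 * M * N x := fun x => by
      refine (map_sub_le_add N _ _).trans ?_
      rw [map_smul_eq_mul]
      nlinarith [hT x, mul_le_mul_of_nonneg_right h2 (apply_nonneg N x)]
    have hTz : N (T z) ≤ 2 * M * N (T x) := by
      have := hsub (T x)
      rwa [hz, map_sub, map_smul]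
    have hx : N x ≤ N z + N (T x) := by
      have h3 : μ • x = T x - z := by rw [hz]; abel
      have h4 : N (μ • x) ≤ N (T x) + N z := by rw [h3]; exact map_sub_le_add N _ _
      rw [map_smul_eq_mul] at h4
      nlinarith [mul_le_mul_of_nonneg_right h1 (apply_nonneg N x)]
    have h5 := ih (fun μ hμ => hs μ (Multiset.mem_cons_of_mem hμ)) z
    have h6 := mul_le_mul_of_nonneg_left hTz
      (Finset.sum_nonneg fun i (_ : i ∈ Finset.range (Multiset.card s)) =>
        pow_nonneg (mul_nonneg zero_le_two hM) i)
    have h7 : ∑ i ∈ Finset.range (Multiset.card (μ ::ₘ s)), (2 * M) ^ i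
        = (∑ i ∈ Finset.range (Multiset.card s), (2 * M) ^ i) * (2 * M) + 1 := by
      rw [Multiset.card_cons, Finset.sum_range_succ', Finset.sum_mul]
      simp only [pow_succ, pow_zero]
    rw [e, h7]
    linarith

lemma seminorm_le_of_eigenvalues {E : Type*} [AddCommGroup E] [Module ℂ E] [FiniteDimensional ℂ E]
    (N : Seminorm ℂ E) (T : Module.End ℂ E) {M : ℝ} (hM : 0 ≤ M) (hT : ∀ x, N (T x) ≤ M * N x)
    (hev : ∀ μ, T.HasEigenvalue μ → 1 ≤ ‖μ‖ ∧ ‖μ‖ ≤ M) (x : E) :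
    N x ≤ (∑ i ∈ Finset.range (Module.finrank ℂ E), (2 * M) ^ i) * N (T x) := by
  have hsp := IsAlgClosed.splits (LinearMap.charpoly T)
  have hprod := hsp.eq_prod_roots
  rw [(LinearMap.charpoly_monic T).leadingCoeff, Polynomial.C_1, one_mul] at hprod
  have h := seminorm_le_of_aeval_prod N T hM hT (LinearMap.charpoly T).roots
    (fun μ hμ => hev μ ((Module.End.hasEigenvalue_iff_isRoot_charpoly T μ).2
      (Polynomial.isRoot_of_mem_roots hμ))) x
  rwa [← hprod, LinearMap.aeval_self_charpoly, LinearMap.zero_apply, map_zero, zero_add,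
    ← hsp.natDegree_eq_card_roots, LinearMap.charpoly_natDegree] at h

lemma summable_weight {r : ℝ} (hr : 1 < r) : Summable fun n : ℕ => (1 + (n : ℝ) ^ 2) ^ (-(r / 2)) := by
  have h := (Real.summable_nat_rpow_inv (p := r)).2 hr
  refine (h.add (summable_of_ne_finset_zero (s := {0})
    (f := fun n : ℕ => if n = 0 then (1 : ℝ) else 0) (by simp))).of_nonneg_of_le
    (fun _ => by positivity) fun n => ?_
  rcases Nat.eq_zero_or_pos n with rfl | hn
  · have : (0 : ℝ) ≤ (((0 : ℕ) : ℝ) ^ r)⁻¹ := by positivity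
    simpa using this
  · have hn' : (0 : ℝ) < n := by exact_mod_cast hn
    rw [if_neg hn.ne', add_zero, Real.rpow_neg (by positivity)]
    refine inv_anti₀ (by positivity) ?_
    calc (n : ℝ) ^ r = ((n : ℝ) ^ (2 : ℝ)) ^ (r / 2) := by
          rw [← Real.rpow_mul hn'.le]; congr 1; ring
      _ ≤ _ := by
          refine Real.rpow_le_rpow (by positivity) ?_ (by linarith)
          rw [Real.rpow_two]
          linarith

lemma summable_shift_mul {s : ℝ} (hs : 1 < s) {u w : ℕ → ℂ} (hu : InHs s u)
    (hw : Summable fun p => ‖w p‖ ^ 2) :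
    (∀ n, Summable fun p => ‖u (n + p)‖ * ‖w p‖) ∧
      Summable fun n => ∑' p, ‖u (n + p)‖ * ‖w p‖ := by
  set a := ∑' k : ℕ, ((1 : ℝ) + (k : ℝ) ^ 2) ^ s * ‖u k‖ ^ 2
  let c : ℕ → ℝ := fun n => (1 + (n : ℝ) ^ 2) ^ (-(s / 2))
  have hc : ∀ n, 0 < c n := fun n => by positivity
  have hinv : ∀ n, c n * ((1 + (n : ℝ) ^ 2) ^ s * c n) = 1 := fun n => by
    have h0 : (0 : ℝ) < 1 + (n : ℝ) ^ 2 := by positivity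
    simp only [c]
    rw [← Real.rpow_add h0, ← Real.rpow_add h0]
    ring_nf
    exact Real.rpow_zero _
  have hsh : ∀ n, Summable fun p : ℕ => (1 + ((n + p : ℕ) : ℝ) ^ 2) ^ s * ‖u (n + p)‖ ^ 2 :=
    fun n => hu.comp_injective (add_right_injective n)
  have hmaj : ∀ n, Summable fun p : ℕ =>
      c n * ((1 + ((n + p : ℕ) : ℝ) ^ 2) ^ s * ‖u (n + p)‖ ^ 2 + ‖w p‖ ^ 2) :=
    fun n => ((hsh n).add hw).mul_left _
  have hle : ∀ n p, ‖u (n + p)‖ * ‖w p‖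
      ≤ c n * ((1 + ((n + p : ℕ) : ℝ) ^ 2) ^ s * ‖u (n + p)‖ ^ 2 + ‖w p‖ ^ 2) := fun n p => by
    have h1 : (1 + (n : ℝ) ^ 2) ^ s * ‖u (n + p)‖ ^ 2
        ≤ (1 + ((n + p : ℕ) : ℝ) ^ 2) ^ s * ‖u (n + p)‖ ^ 2 := by gcongr; simp
    refine le_trans ?_ (mul_le_mul_of_nonneg_left (add_le_add_left h1 _) (hc n).le)
    set b := (1 + (n : ℝ) ^ 2) ^ s
    have hb : 0 < b := by positivity
    have hi := hinv n
    have h2 : c n * (b * ‖u (n + p)‖ ^ 2 + ‖w p‖ ^ 2) - ‖u (n + p)‖ * ‖w p‖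
        = c n * (b * (‖u (n + p)‖ - c n * ‖w p‖ / 2) ^ 2 + 3 / 4 * ‖w p‖ ^ 2) := by
      linear_combination (‖u (n + p)‖ * ‖w p‖ - c n * ‖w p‖ ^ 2 / 4) * hi
    have h3 : 0 ≤ c n * (b * (‖u (n + p)‖ - c n * ‖w p‖ / 2) ^ 2 + 3 / 4 * ‖w p‖ ^ 2) :=
      mul_nonneg (hc n).le (by positivity)
    linarith
  have hS : ∀ n, Summable fun p => ‖u (n + p)‖ * ‖w p‖ := fun n =>
    (hmaj n).of_nonneg_of_le (fun _ => by positivity) (hle n)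
  refine ⟨hS, ((summable_weight hs).mul_right (a + ∑' p, ‖w p‖ ^ 2)).of_nonneg_of_le
    (fun n => tsum_nonneg fun _ => by positivity) fun n => ?_⟩
  refine ((hS n).tsum_le_tsum (hle n) (hmaj n)).trans ?_
  rw [tsum_mul_left, (hsh n).tsum_add hw]
  refine mul_le_mul_of_nonneg_left (add_le_add_left ?_ _) (hc n).le
  exact tsum_comp_le_tsum_of_inj hu (fun _ => by positivity) (add_right_injective n)

lemma inW_hankel_of_inHs {s : ℝ} (hs : 1 < s) {u w : ℕ → ℂ} (hu : InHs s u)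
    (hw : Summable fun p => ‖w p‖ ^ 2) : InW (hankel u w) := by
  obtain ⟨h1, h2⟩ := summable_shift_mul hs hu hw
  refine h2.of_nonneg_of_le (fun _ => norm_nonneg _) fun n => ?_
  have h3 : (fun p => ‖u (n + p) * conj (w p)‖) = fun p => ‖u (n + p)‖ * ‖w p‖ := by
    ext p; rw [norm_mul, RCLike.norm_conj]
  rw [← h3]
  exact norm_tsum_le_tsum_norm (by rw [h3]; exact h1 n)

lemma InHs.inW {s : ℝ} (hs : 1 < s) {u : ℕ → ℂ} (hu : InHs s u) : InW u := by
  have h := inW_hankel_of_inHs hs hu (w := Pi.single 0 1)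
    (summable_of_ne_finset_zero (s := {0}) fun p hp => by
      simp [Pi.single_eq_of_ne (Finset.notMem_singleton.1 hp)])
  have e : hankel u (Pi.single 0 1) = u := by
    ext n
    rw [hankel, tsum_eq_single 0 fun p hp => by simp [Pi.single_eq_of_ne hp]]
    simp
  rwa [e] at h

/-- The square `H_u²` acting on the range of `H_u`. -/
def hankelSq (u : ℕ → ℂ) (hu : InW u) [FiniteDimensional ℂ (LinearMap.range (hankelLM u))] :
    Module.End ℂ (LinearMap.range (hankelLM u)) where
  toFun x := ⟨hankel u (hankel u x), hankel_mem_range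
    (hu.summable_hankel (inW_hankel hu (inW_of_mem_range hu x.2)).1)⟩
  map_add' x z := by
    have hx := inW_of_mem_range hu x.2
    have hz := inW_of_mem_range hu z.2
    ext1
    simp only [Submodule.coe_add]
    rw [hankel_add hu hx hz, hankel_add hu (inW_hankel hu hx).1 (inW_hankel hu hz).1]
  map_smul' c x := by
    ext1
    simp [hankel_smul]

/-- The Wiener norm as a seminorm on the range of `H_u`. -/
def wienerSeminorm (u : ℕ → ℂ) (hu : InW u) : Seminorm ℂ (LinearMap.range (hankelLM u)) :=
  Seminorm.of (fun x => wienerNorm x)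
    (fun x z => wienerNorm_add_le (inW_of_mem_range hu x.2) (inW_of_mem_range hu z.2))
    fun c x => wienerNorm_smul c x

lemma wienerNorm_hankel_hankel_le {u v : ℕ → ℂ} (hu : InW u) (hv : InW v) {R : ℝ}
    (hR : wienerNorm u ≤ R) : wienerNorm (hankel u (hankel u v)) ≤ R ^ 2 * wienerNorm v := by
  obtain ⟨h1, h2⟩ := inW_hankel hu hv
  obtain ⟨-, h4⟩ := inW_hankel hu h1
  have h0 := wienerNorm_nonneg u
  have h5 := h0.trans hR
  calc _ ≤ wienerNorm u * (wienerNorm u * wienerNorm v) := h4.trans (by gcongr)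
    _ ≤ R * (R * wienerNorm v) := by
      have := wienerNorm_nonneg v
      gcongr
    _ = _ := by ring

lemma wienerNorm_le_of_mem_range {u : ℕ → ℂ} (hu : InW u)
    [FiniteDimensional ℂ (LinearMap.range (hankelLM u))] {R y : ℝ} (hy : 0 ≤ y)
    (hR : wienerNorm u ≤ R) {v : ℕ → ℂ} (hv : v ∈ LinearMap.range (hankelLM u)) :
    wienerNorm v ≤ (∑ i ∈ Finset.range (hankelRank u), (2 * (1 + y * R ^ 2)) ^ i) *
      wienerNorm (v + (y : ℂ) • hankel u (hankel u v)) := by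
  let T : Module.End ℂ (LinearMap.range (hankelLM u)) := 1 + (y : ℂ) • hankelSq u hu
  have hTc : ∀ x : LinearMap.range (hankelLM u),
      ((T x : LinearMap.range (hankelLM u)) : ℕ → ℂ)
        = (x : ℕ → ℂ) + (y : ℂ) • hankel u (hankel u x) := fun _ => rfl
  have hT : ∀ x, wienerSeminorm u hu (T x) ≤ (1 + y * R ^ 2) * wienerSeminorm u hu x := by
    intro x
    have hx := inW_of_mem_range hu x.2
    have hA := (inW_hankel hu (inW_hankel hu hx).1).1
    change wienerNorm (T x) ≤ (1 + y * R ^ 2) * wienerNorm x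
    rw [hTc]
    refine (wienerNorm_add_le hx (hA.const_smul _)).trans ?_
    rw [wienerNorm_smul, Complex.norm_real, Real.norm_of_nonneg hy]
    nlinarith [mul_le_mul_of_nonneg_left (wienerNorm_hankel_hankel_le hu hx hR) hy]
  refine seminorm_le_of_eigenvalues (wienerSeminorm u hu) T (by positivity) hT
    (fun μ hμ => ?_) ⟨v, hv⟩
  obtain ⟨x, hx⟩ := hμ.exists_hasEigenvector
  have hxe := hx.apply_eq_smul
  have hx0 : (x : ℕ → ℂ) ≠ 0 := fun h => hx.2 (Subtype.ext h)
  have hxW := inW_of_mem_range hu x.2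
  refine ⟨one_le_norm_of_eigen hu hxW hx0 hy (congrArg Subtype.val hxe), ?_⟩
  have h1 := hT x
  rw [hxe, map_smul_eq_mul] at h1
  exact le_of_mul_le_mul_right h1 (wienerNorm_pos hxW hx0)

lemma inW_single : InW (Pi.single 0 1) :=
  summable_of_ne_finset_zero (s := {0}) fun p hp => by
    simp [Pi.single_eq_of_ne (Finset.notMem_singleton.1 hp)]

lemma wienerNorm_single : wienerNorm (Pi.single 0 1) = 1 := by
  rw [wienerNorm, tsum_eq_single 0 fun p hp => by simp [Pi.single_eq_of_ne hp]]
  simp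

lemma inHs_single (s : ℝ) : InHs s (Pi.single 0 1) ∧ hsNorm s (Pi.single 0 1) = 1 := by
  refine ⟨summable_of_ne_finset_zero (s := {0}) fun p hp => by
    simp [Pi.single_eq_of_ne (Finset.notMem_singleton.1 hp)], ?_⟩
  rw [hsNorm, tsum_eq_single 0 fun p hp => by simp [Pi.single_eq_of_ne hp]]
  simp

lemma IsResolventOne.eq {y : ℝ} {u w : ℕ → ℂ} (h : IsResolventOne y u w) :
    w = Pi.single 0 1 + -(y : ℂ) • hankel u (hankel u w) := by
  ext n
  have := h.2 n
  simp only [Pi.add_apply, Pi.smul_apply, smul_eq_mul, Pi.single_apply]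
  linear_combination this

lemma IsResolventOne.wienerNorm_le {s : ℝ} (hs : 1 < s) {y R : ℝ} (hy : 0 ≤ y) {u w : ℕ → ℂ}
    [FiniteDimensional ℂ (LinearMap.range (hankelLM u))] (hu : InHs s u)
    (hR : wienerNorm u ≤ R) (h : IsResolventOne y u w) :
    InW w ∧ wienerNorm w ≤
      1 + (∑ i ∈ Finset.range (hankelRank u), (2 * (1 + y * R ^ 2)) ^ i) * (y * R ^ 2) := by
  have huW := hu.inW hs
  have hw2 : Summable fun p => ‖w p‖ ^ 2 := by
    simpa using (memℓp_gen_iff (p := 2) (by norm_num)).1 h.1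
  have hHw := inW_hankel_of_inHs hs hu hw2
  set v : ℕ → ℂ := -(y : ℂ) • hankel u (hankel u w) with hv
  have hvW : InW v := (inW_hankel huW hHw).1.const_smul _
  have hwv : w = Pi.single 0 1 + v := h.eq
  have hvm : v ∈ LinearMap.range (hankelLM u) :=
    Submodule.smul_mem _ _ (hankel_mem_range (huW.summable_hankel hHw))
  have hTv : v + (y : ℂ) • hankel u (hankel u v)
      = -(y : ℂ) • hankel u (hankel u (Pi.single 0 1)) := by
    have h1 : hankel u (hankel u w)
        = hankel u (hankel u (Pi.single 0 1)) + hankel u (hankel u v) := by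
      rw [hwv, hankel_add huW inW_single hvW,
        hankel_add huW (inW_hankel huW inW_single).1 (inW_hankel huW hvW).1]
    nth_rewrite 1 [hv]
    rw [h1]
    module
  have hb := wienerNorm_le_of_mem_range huW hy hR hvm
  have hN := wienerNorm_hankel_hankel_le huW inW_single hR
  rw [wienerNorm_single, mul_one] at hN
  rw [hTv, wienerNorm_smul _ (hankel u (hankel u (Pi.single 0 1))), norm_neg,
    Complex.norm_real, Real.norm_of_nonneg hy] at hb
  rw [hwv]
  refine ⟨inW_single.add hvW, (wienerNorm_add_le inW_single hvW).trans ?_⟩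
  rw [wienerNorm_single]
  refine add_le_add le_rfl (hb.trans (mul_le_mul_of_nonneg_left
    (mul_le_mul_of_nonneg_left hN hy) (Finset.sum_nonneg fun i _ => by positivity)))

/-- **Lemma 5.7**: for `u ∈ 𝒱(d)` with `‖u‖_W ≤ R`,
`‖X_{J^y}(u)‖_{H^s} ≤ C(d,R,y,s)(1 + ‖u‖_{H^s})`, `s > 1`. -/
theorem statement18 (d : ℕ) (hd : 0 < d) (R y s : ℝ) (hR : 0 ≤ R) (hy : 0 ≤ y) (hs : 1 < s) :
    ∃ C : ℝ, 0 < C ∧ ∀ u w : ℕ → ℂ, InV d u → InHs s u → wienerNorm u ≤ R →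
      IsResolventOne y u w →
      InHs s (XJ y u w) ∧ hsNorm s (XJ y u w) ≤ C * (1 + hsNorm s u) := by
  set D : ℝ := 1 + (∑ i ∈ Finset.range ((d + 1) / 2), (2 * (1 + y * R ^ 2)) ^ i) * (y * R ^ 2)
    with hD
  have hD0 : 0 < D := by positivity
  have hs0 : 0 ≤ s := by linarith
  refine ⟨2 * y * (2 ^ s * (D * D + R * D * (1 + y * (R * D)))) + 1, by positivity,
    fun u w hV hu hR' hw => ?_⟩
  obtain ⟨-, hfin, hrank, -⟩ := hV
  obtain ⟨hwW, hwD⟩ := hw.wienerNorm_le hs hy hu hR'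
  rw [hrank, ← hD] at hwD
  have huW := hu.inW hs
  obtain ⟨hHW, hHN⟩ := inW_hankel huW hwW
  have hHN' : wienerNorm (hankel u w) ≤ R * D :=
    hHN.trans (mul_le_mul hR' hwD (wienerNorm_nonneg _) hR)
  have hn := hsNorm_nonneg s u
  obtain ⟨hHs, hHb⟩ := inHs_hankel hs0 hu hwW
  obtain ⟨hAs, hAb⟩ := inHs_hankel hs0 hu hHW
  have hHb' : hsNorm s (hankel u w) ≤ D * hsNorm s u := hHb.trans (by gcongr)
  have hAb' : hsNorm s (hankel u (hankel u w)) ≤ R * D * hsNorm s u := hAb.trans (by gcongr)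
  have hws : InHs s w ∧ hsNorm s w ≤ 1 + y * (R * D * hsNorm s u) := by
    obtain ⟨h1, h2⟩ := hAs.const_mul (-(y : ℂ))
    obtain ⟨h3, h4⟩ := (inHs_single s).1.add h1
    have e : w = fun n => (Pi.single 0 1 : ℕ → ℂ) n + -(y : ℂ) * hankel u (hankel u w) n := hw.eq
    rw [← e] at h3 h4
    rw [norm_neg, Complex.norm_real, Real.norm_of_nonneg hy] at h2
    rw [(inHs_single s).2] at h4
    exact ⟨h3, h4.trans (by gcongr; exact h2.trans (by gcongr))⟩
  obtain ⟨hm, hmb⟩ := inHs_mulCoeff hs0 hws.1 hHs hwW hHW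
  obtain ⟨hX, hXb⟩ := hm.const_mul (2 * Complex.I * (y : ℂ))
  refine ⟨hX, hXb.trans ?_⟩
  have hc : ‖2 * Complex.I * (y : ℂ)‖ = 2 * y := by
    simp [abs_of_nonneg hy]
  rw [hc]
  have h5 : wienerNorm w * hsNorm s (hankel u w) + wienerNorm (hankel u w) * hsNorm s w
      ≤ D * (D * hsNorm s u) + R * D * (1 + y * (R * D * hsNorm s u)) := by
    have := hsNorm_nonneg s (hankel u w)
    have := hsNorm_nonneg s w
    gcongr
    exact hws.2
  have h6 : D * (D * hsNorm s u) + R * D * (1 + y * (R * D * hsNorm s u))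
      ≤ (D * D + R * D * (1 + y * (R * D))) * (1 + hsNorm s u) := by
    have : 0 ≤ D * D + R * D * hsNorm s u + R * D * (y * (R * D)) := by positivity
    linarith
  calc 2 * y * hsNorm s (mulCoeff w (hankel u w))
      ≤ 2 * y * (2 ^ s * ((D * D + R * D * (1 + y * (R * D))) * (1 + hsNorm s u))) := by
        gcongr
        exact hmb.trans (by gcongr; exact h5.trans h6)
    _ ≤ _ := by linarith

end
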